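/- arXiv:1609.09178 — 6 statements merged into one kernel-verified Lean document; each statement's English description precedes it below -/
import Mathlib

section
/- Let x_t, x_p, x_q ∈ ℝ^d satisfy ‖x_t‖₂ ≤ 1, ‖x_p‖₂ ≤ 1, ‖x_q‖₂ ≤ 1, set a = x_t − x_p, b = x_t − x_q and A_t = a aᵀ − b bᵀ, and suppose a and b are linearly independent (so A_t has rank 2). If 0 < γ < 1/4, then η + β ≠ 0 and (I + γ A_t)⁻¹ = I − (1/(η + β)) · [η γ A_t − (γ A_t)²], where η = 1 + tr(γ A_t) and β = ½[(tr(γ A_t))² − tr((γ A_t)²)]. (Theorem 1) -/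
/-- The Euclidean (ℓ₂) norm of a vector in `ℝ^d`. -/
noncomputable def enorm {d : ℕ} (v : Fin d → ℝ) : ℝ := Real.sqrt (∑ i, v i ^ 2)

theorem enorm_sq_le {d : ℕ} (v : Fin d → ℝ) (h : _root_.enorm v ≤ 1) : ∑ i, v i ^ 2 ≤ 1 := by
  unfold _root_.enorm at h
  have h0 : 0 ≤ ∑ i, v i ^ 2 := Finset.sum_nonneg fun i _ => sq_nonneg _
  rw [Real.sqrt_le_left (by norm_num), one_pow] at h
  exact h

theorem dot_sub_le {d : ℕ} (v w : Fin d → ℝ) (hv : ∑ i, v i ^ 2 ≤ 1) (hw : ∑ i, w i ^ 2 ≤ 1) :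
    (v - w) ⬝ᵥ (v - w) ≤ 4 := by
  have : (v - w) ⬝ᵥ (v - w) ≤ ∑ i, (2 * v i ^ 2 + 2 * w i ^ 2) := by
    unfold dotProduct
    refine Finset.sum_le_sum fun i _ => ?_
    simp only [Pi.sub_apply]
    nlinarith [sq_nonneg (v i + w i)]
  rw [Finset.sum_add_distrib, ← Finset.mul_sum, ← Finset.mul_sum] at this
  linarith

theorem vmv_mul {d : ℕ} (a b c e : Fin d → ℝ) :
    Matrix.vecMulVec a b * Matrix.vecMulVec c e = (b ⬝ᵥ c) • Matrix.vecMulVec a e := by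
  rw [Matrix.vecMulVec_mul_vecMulVec, Matrix.vecMulVec_smul]

theorem sq_formula {d : ℕ} (a b : Fin d → ℝ) :
    (Matrix.vecMulVec a a - Matrix.vecMulVec b b) * (Matrix.vecMulVec a a - Matrix.vecMulVec b b)
      = (a ⬝ᵥ a) • Matrix.vecMulVec a a + (b ⬝ᵥ b) • Matrix.vecMulVec b b
        - (a ⬝ᵥ b) • Matrix.vecMulVec a b - (a ⬝ᵥ b) • Matrix.vecMulVec b a := by
  simp only [sub_mul, mul_sub, vmv_mul, dotProduct_comm b a]
  module

theorem cube_formula {d : ℕ} (a b : Fin d → ℝ) (A : Matrix (Fin d) (Fin d) ℝ)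
    (hA : A = Matrix.vecMulVec a a - Matrix.vecMulVec b b) :
    A * (A * A) = (a ⬝ᵥ a - b ⬝ᵥ b) • (A * A)
      + ((a ⬝ᵥ a) * (b ⬝ᵥ b) - (a ⬝ᵥ b) ^ 2) • A := by
  subst hA
  rw [sq_formula]
  simp only [sub_mul, mul_sub, mul_add, mul_smul_comm, vmv_mul, dotProduct_comm b a]
  module

/-- **Theorem 1** (OPML paper). For normalized samples `x_t, x_p, x_q`, with
`a = x_t - x_p`, `b = x_t - x_q` linearly independent (so `A_t = a aᵀ - b bᵀ` has rank 2) and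
`0 < γ < 1/4`, one has `η + β ≠ 0` and
`(I + γ A_t)⁻¹ = I - (1/(η+β)) • (η (γ A_t) - (γ A_t)²)` where `η = 1 + tr(γ A_t)` and
`β = ½[(tr(γ A_t))² - tr((γ A_t)²)]`. -/
theorem stmt_4 {d : ℕ} (xt xp xq : Fin d → ℝ)
    (ht : _root_.enorm xt ≤ 1) (hp : _root_.enorm xp ≤ 1) (hq : _root_.enorm xq ≤ 1)
    (hab : LinearIndependent ℝ ![xt - xp, xt - xq])
    (γ : ℝ) (hγ0 : 0 < γ) (hγ1 : γ < 1 / 4) :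
    let A : Matrix (Fin d) (Fin d) ℝ :=
      Matrix.vecMulVec (xt - xp) (xt - xp) - Matrix.vecMulVec (xt - xq) (xt - xq)
    let η : ℝ := 1 + Matrix.trace (γ • A)
    let β : ℝ := (1 / 2) * (Matrix.trace (γ • A) ^ 2 - Matrix.trace ((γ • A) * (γ • A)))
    η + β ≠ 0 ∧
      ((1 : Matrix (Fin d) (Fin d) ℝ) + γ • A)⁻¹ =
        1 - (η + β)⁻¹ • (η • (γ • A) - (γ • A) * (γ • A)) := by
  intro A η β
  have hq4 := dot_sub_le xt xq (enorm_sq_le _ ht) (enorm_sq_le _ hq)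
  have hp0 : 0 ≤ (xt - xp) ⬝ᵥ (xt - xp) := Finset.sum_nonneg fun i _ => mul_self_nonneg _
  have hC := cube_formula (xt - xp) (xt - xq) A rfl
  have hS := sq_formula (xt - xp) (xt - xq)
  have hS' : A * A = _ := hS
  have ht1 : Matrix.trace A = (xt - xp) ⬝ᵥ (xt - xp) - (xt - xq) ⬝ᵥ (xt - xq) := by
    simp only [A, Matrix.trace_sub, Matrix.trace_vecMulVec]
  have ht2 : Matrix.trace (A * A) = ((xt - xp) ⬝ᵥ (xt - xp)) ^ 2 + ((xt - xq) ⬝ᵥ (xt - xq)) ^ 2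
      - 2 * ((xt - xp) ⬝ᵥ (xt - xq)) ^ 2 := by
    rw [hS']
    simp only [Matrix.trace_sub, Matrix.trace_add, Matrix.trace_smul, Matrix.trace_vecMulVec,
      smul_eq_mul, dotProduct_comm (xt - xq) (xt - xp)]
    ring
  clear_value A
  generalize (xt - xp) ⬝ᵥ (xt - xp) = p at *
  generalize (xt - xq) ⬝ᵥ (xt - xq) = q at *
  generalize (xt - xp) ⬝ᵥ (xt - xq) = r at *
  have hη : η = 1 + γ * (p - q) := by
    simp only [η, Matrix.trace_smul, ht1, smul_eq_mul]
  have hβ : β = γ ^ 2 * (r ^ 2 - p * q) := by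
    simp only [β, Matrix.trace_smul, ht1, smul_eq_mul, smul_mul_assoc, mul_smul_comm, ht2]
    ring
  clear_value η β
  have hpos : 0 < η + β := by
    have h1 : 0 < 1 - γ * q := by nlinarith
    have h2 : 0 < 1 + γ * p := by positivity
    have : η + β = (1 + γ * p) * (1 - γ * q) + (γ * r) ^ 2 := by rw [hη, hβ]; ring
    rw [this]
    positivity
  refine ⟨hpos.ne', Matrix.inv_eq_right_inv ?_⟩
  have key : (1 + γ • A) * (η • (γ • A) - (γ • A) * (γ • A)) = (η + β) • (γ • A) := by
    simp only [add_mul, mul_sub, one_mul, smul_mul_assoc, mul_smul_comm, hC, hη, hβ]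
    module
  rw [mul_sub, mul_one, mul_smul_comm, key, smul_smul, inv_mul_cancel₀ hpos.ne', one_smul]
  simp
end

section
/- Let x_t, x_p, x_q ∈ ℝ^d satisfy ‖x_t‖₂ ≤ R, ‖x_p‖₂ ≤ R, ‖x_q‖₂ ≤ R, set a = x_t − x_p, b = x_t − x_q and A_t = a aᵀ − b bᵀ, and let 0 < γ < 1/4. Then β = ½[(tr(γ A_t))² − tr((γ A_t)²)] satisfies −R⁴ < β < (25/32)R⁴. -/
lemma sum_sq_le_of_enorm {d : ℕ} {R : ℝ} (hR : 0 < R) {v : Fin d → ℝ}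
    (h : _root_.enorm v ≤ R) : ∑ i, v i ^ 2 ≤ R ^ 2 := by
  unfold _root_.enorm at h
  exact (Real.sqrt_le_left hR.le).mp h

lemma diff_sq_le {d : ℕ} {R : ℝ} (hR : 0 < R) {v w : Fin d → ℝ}
    (hv : _root_.enorm v ≤ R) (hw : _root_.enorm w ≤ R) :
    (v - w) ⬝ᵥ (v - w) ≤ 4 * R ^ 2 := by
  have h1 := sum_sq_le_of_enorm hR hv
  have h2 := sum_sq_le_of_enorm hR hw
  have h3 : (v - w) ⬝ᵥ (v - w) ≤ ∑ i, (2 * v i ^ 2 + 2 * w i ^ 2) := by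
    unfold dotProduct
    apply Finset.sum_le_sum
    intro i _
    simp only [Pi.sub_apply]
    nlinarith [sq_nonneg (v i + w i)]
  rw [Finset.sum_add_distrib, ← Finset.mul_sum, ← Finset.mul_sum] at h3
  linarith

lemma dot_cs {d : ℕ} (a b : Fin d → ℝ) : (a ⬝ᵥ b) ^ 2 ≤ (a ⬝ᵥ a) * (b ⬝ᵥ b) := by
  have h := Finset.sum_mul_sq_le_sq_mul_sq Finset.univ a b
  simpa only [dotProduct, pow_two] using h

lemma beta_eq {d : ℕ} (a b : Fin d → ℝ) (γ : ℝ) :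
    (1 / 2) * (Matrix.trace (γ • (Matrix.vecMulVec a a - Matrix.vecMulVec b b)) ^ 2
      - Matrix.trace ((γ • (Matrix.vecMulVec a a - Matrix.vecMulVec b b)) *
        (γ • (Matrix.vecMulVec a a - Matrix.vecMulVec b b))))
      = γ ^ 2 * ((a ⬝ᵥ b) ^ 2 - (a ⬝ᵥ a) * (b ⬝ᵥ b)) := by
  simp only [Matrix.smul_mul, Matrix.mul_smul, Matrix.trace_smul, Matrix.trace_sub, sub_mul,
    mul_sub, Matrix.vecMulVec_mul_vecMulVec, Matrix.trace_vecMulVec, smul_eq_mul,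
    dotProduct_smul, smul_dotProduct, dotProduct_comm b a]
  ring

/-- Range of `β = ½[(tr(γ A_t))² - tr((γ A_t)²)]` from the proof of Theorem 2 of the OPML
paper: if `‖x_t‖₂, ‖x_p‖₂, ‖x_q‖₂ ≤ R` (with `0 < R`), `a = x_t - x_p`, `b = x_t - x_q`,
`A_t = a aᵀ - b bᵀ` and `0 < γ < 1/4`, then `-R⁴ < β < (25/32) R⁴`. -/
theorem stmt_9 {d : ℕ} (R : ℝ) (hR : 0 < R) (xt xp xq : Fin d → ℝ)
    (ht : _root_.enorm xt ≤ R) (hp : _root_.enorm xp ≤ R) (hq : _root_.enorm xq ≤ R)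
    (γ : ℝ) (hγ0 : 0 < γ) (hγ1 : γ < 1 / 4) :
    let A : Matrix (Fin d) (Fin d) ℝ :=
      Matrix.vecMulVec (xt - xp) (xt - xp) - Matrix.vecMulVec (xt - xq) (xt - xq)
    let β : ℝ := (1 / 2) * (Matrix.trace (γ • A) ^ 2 - Matrix.trace ((γ • A) * (γ • A)))
    (-(R ^ 4) < β) ∧ β < 25 / 32 * R ^ 4 := by
  intro A β
  have hβ : β = γ ^ 2 * (((xt - xp) ⬝ᵥ (xt - xq)) ^ 2
      - ((xt - xp) ⬝ᵥ (xt - xp)) * ((xt - xq) ⬝ᵥ (xt - xq))) := beta_eq _ _ _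
  rw [hβ]
  have hs := diff_sq_le hR ht hp
  have hu := diff_sq_le hR ht hq
  have hc := dot_cs (xt - xp) (xt - xq)
  have hs0 : 0 ≤ (xt - xp) ⬝ᵥ (xt - xp) := Finset.sum_nonneg fun i _ => mul_self_nonneg _
  have hu0 : 0 ≤ (xt - xq) ⬝ᵥ (xt - xq) := Finset.sum_nonneg fun i _ => mul_self_nonneg _
  generalize (xt - xp) ⬝ᵥ (xt - xp) = s at *
  generalize (xt - xq) ⬝ᵥ (xt - xq) = u at *
  generalize (xt - xp) ⬝ᵥ (xt - xq) = c at *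
  have hR4 : 0 < R ^ 4 := by positivity
  have hg : γ ^ 2 < 1 / 16 := by nlinarith
  have hg0 : 0 ≤ γ ^ 2 := sq_nonneg _
  have hsu : s * u ≤ 16 * R ^ 4 := by
    have := mul_le_mul hs hu hu0 (by positivity)
    linarith
  constructor
  · have h1 : γ ^ 2 * (s * u) ≤ γ ^ 2 * (16 * R ^ 4) := mul_le_mul_of_nonneg_left hsu hg0
    have h2 : γ ^ 2 * (16 * R ^ 4) < 1 / 16 * (16 * R ^ 4) :=
      mul_lt_mul_of_pos_right hg (by positivity)
    have h3 : 0 ≤ γ ^ 2 * c ^ 2 := by positivity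
    linarith
  · have h1 : γ ^ 2 * (c ^ 2 - s * u) ≤ 0 :=
      mul_nonpos_of_nonneg_of_nonpos hg0 (by linarith)
    linarith
end

section
/- Let x_t, x_p, x_q ∈ ℝ^d satisfy ‖x_t‖₂ ≤ R, ‖x_p‖₂ ≤ R, ‖x_q‖₂ ≤ R, set a = x_t − x_p, b = x_t − x_q and A_t = a aᵀ − b bᵀ, let γ ∈ ℝ with 0 < γ < 1/4, let η = 1 + tr(γ A_t), β = ½[(tr(γ A_t))² − tr((γ A_t)²)], and suppose η + β ≠ 0. Then the matrix B = (1/(η + β))·[(γ A_t)² − η γ A_t] satisfies ‖B‖_F ≤ 32·|γ²/(η + β)|·R⁴ + 4√2·|η γ/(η + β)|·R². -/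
/-- The Frobenius norm of a real matrix. -/
noncomputable def frobNorm {m n : ℕ} (A : Matrix (Fin m) (Fin n) ℝ) : ℝ :=
  Real.sqrt (∑ i, ∑ j, A i j ^ 2)

section FrobHelpers

attribute [local instance] Matrix.frobeniusNormedAddCommGroup Matrix.frobeniusNormedSpace
  Matrix.frobeniusNormedRing

theorem frobNorm_eq_norm {m n : ℕ} (A : Matrix (Fin m) (Fin n) ℝ) : frobNorm A = ‖A‖ := by
  rw [Matrix.frobenius_norm_def, frobNorm, Real.sqrt_eq_rpow]
  simp

theorem frobNorm_mul_le {n : ℕ} (A B : Matrix (Fin n) (Fin n) ℝ) :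
    frobNorm (A * B) ≤ frobNorm A * frobNorm B := by
  simp only [frobNorm_eq_norm]
  exact Matrix.frobenius_norm_mul A B

theorem frobNorm_sub_le {n : ℕ} (A B : Matrix (Fin n) (Fin n) ℝ) :
    frobNorm (A - B) ≤ frobNorm A + frobNorm B := by
  simp only [frobNorm_eq_norm]
  exact norm_sub_le A B

theorem frobNorm_smul {n : ℕ} (c : ℝ) (A : Matrix (Fin n) (Fin n) ℝ) :
    frobNorm (c • A) = |c| * frobNorm A := by
  simp only [frobNorm_eq_norm]
  rw [norm_smul, Real.norm_eq_abs]

end FrobHelpers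

theorem enorm_eq_norm_toLp {d : ℕ} (v : Fin d → ℝ) :
    _root_.enorm v = ‖(WithLp.toLp 2 v : EuclideanSpace ℝ (Fin d))‖ := by
  rw [EuclideanSpace.norm_eq, _root_.enorm]
  simp

theorem sum_sq_sub_le {d : ℕ} (R : ℝ) (x y : Fin d → ℝ)
    (hx : _root_.enorm x ≤ R) (hy : _root_.enorm y ≤ R) :
    ∑ i, (x - y) i ^ 2 ≤ 4 * R ^ 2 := by
  have h : _root_.enorm (x - y) ≤ 2 * R := by
    rw [enorm_eq_norm_toLp] at *
    rw [WithLp.toLp_sub]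
    linarith [norm_sub_le (WithLp.toLp 2 x : EuclideanSpace ℝ (Fin d)) (WithLp.toLp 2 y)]
  have h0 : 0 ≤ ∑ i, (x - y) i ^ 2 := Finset.sum_nonneg fun i _ => sq_nonneg _
  have h1 : 0 ≤ _root_.enorm (x - y) := Real.sqrt_nonneg _
  have h2 : _root_.enorm (x - y) ^ 2 = ∑ i, (x - y) i ^ 2 := Real.sq_sqrt h0
  nlinarith

theorem frobNorm_diff_le {d : ℕ} (R : ℝ) (a b : Fin d → ℝ)
    (ha : ∑ i, a i ^ 2 ≤ 4 * R ^ 2) (hb : ∑ i, b i ^ 2 ≤ 4 * R ^ 2) :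
    frobNorm (Matrix.vecMulVec a a - Matrix.vecMulVec b b) ≤ 4 * Real.sqrt 2 * R ^ 2 := by
  have ha0 : 0 ≤ ∑ i, a i ^ 2 := Finset.sum_nonneg fun i _ => sq_nonneg _
  have hb0 : 0 ≤ ∑ i, b i ^ 2 := Finset.sum_nonneg fun i _ => sq_nonneg _
  have key : ∑ i, ∑ j, (Matrix.vecMulVec a a - Matrix.vecMulVec b b) i j ^ 2
      = (∑ i, a i ^ 2) * (∑ i, a i ^ 2) + (∑ i, b i ^ 2) * (∑ i, b i ^ 2)
        - 2 * ((∑ i, a i * b i) * (∑ i, a i * b i)) := by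
    simp only [Finset.sum_mul_sum]
    simp only [Finset.mul_sum, ← Finset.sum_add_distrib,
      ← Finset.sum_sub_distrib]
    refine Finset.sum_congr rfl fun i _ => Finset.sum_congr rfl fun j _ => ?_
    simp only [Matrix.sub_apply, Matrix.vecMulVec_apply]
    ring
  rw [frobNorm, key]
  apply Real.sqrt_le_iff.2 ⟨by positivity, ?_⟩
  have h2 : Real.sqrt 2 ^ 2 = 2 := Real.sq_sqrt (by norm_num)
  have h3 : (4 * Real.sqrt 2 * R ^ 2) ^ 2 = 32 * (R ^ 2 * R ^ 2) := by
    calc _ = 16 * Real.sqrt 2 ^ 2 * (R ^ 2 * R ^ 2) := by ring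
      _ = _ := by rw [h2]; ring
  rw [h3]
  have := mul_self_le_mul_self ha0 ha
  have := mul_self_le_mul_self hb0 hb
  nlinarith [mul_self_nonneg (∑ i, a i * b i)]

/-- Quantitative content of Theorem 2 of the OPML paper: with `‖x_t‖₂, ‖x_p‖₂, ‖x_q‖₂ ≤ R`,
`A_t = (x_t - x_p)(x_t - x_p)ᵀ - (x_t - x_q)(x_t - x_q)ᵀ`, `0 < γ < 1/4`,
`η = 1 + tr(γ A_t)`, `β = ½[(tr(γ A_t))² - tr((γ A_t)²)]` and `η + β ≠ 0`, the update matrix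
`B = (1/(η+β)) [(γ A_t)² - η γ A_t]` satisfies
`‖B‖_F ≤ 32 |γ²/(η+β)| R⁴ + 4√2 |ηγ/(η+β)| R²`. -/
theorem stmt_10 {d : ℕ} (R : ℝ) (xt xp xq : Fin d → ℝ)
    (ht : _root_.enorm xt ≤ R) (hp : _root_.enorm xp ≤ R) (hq : _root_.enorm xq ≤ R)
    (γ : ℝ) (hγ0 : 0 < γ) (hγ1 : γ < 1 / 4) :
    let A : Matrix (Fin d) (Fin d) ℝ :=
      Matrix.vecMulVec (xt - xp) (xt - xp) - Matrix.vecMulVec (xt - xq) (xt - xq)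
    let η : ℝ := 1 + Matrix.trace (γ • A)
    let β : ℝ := (1 / 2) * (Matrix.trace (γ • A) ^ 2 - Matrix.trace ((γ • A) * (γ • A)))
    η + β ≠ 0 →
      frobNorm ((η + β)⁻¹ • ((γ • A) * (γ • A) - η • (γ • A))) ≤
        32 * |γ ^ 2 / (η + β)| * R ^ 4 + 4 * Real.sqrt 2 * |η * γ / (η + β)| * R ^ 2 := by
  intro A η β _
  have hA : frobNorm A ≤ 4 * Real.sqrt 2 * R ^ 2 :=
    frobNorm_diff_le R _ _ (sum_sq_sub_le R _ _ ht hp) (sum_sq_sub_le R _ _ ht hq)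
  have hA0 : 0 ≤ frobNorm A := Real.sqrt_nonneg _
  have hAA : frobNorm (A * A) ≤ 32 * R ^ 4 := by
    have h2 : Real.sqrt 2 ^ 2 = 2 := Real.sq_sqrt (by norm_num)
    calc _ ≤ frobNorm A * frobNorm A := frobNorm_mul_le A A
      _ ≤ _ := mul_self_le_mul_self hA0 hA
      _ = 16 * Real.sqrt 2 ^ 2 * R ^ 4 := by ring
      _ = _ := by rw [h2]; ring
  clear_value A η β
  have e : (η + β)⁻¹ • ((γ • A) * (γ • A) - η • (γ • A))
      = (γ ^ 2 / (η + β)) • (A * A) - (η * γ / (η + β)) • A := by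
    rw [smul_sub, smul_mul_smul_comm, smul_smul, smul_smul, smul_smul]
    congr 2 <;> ring
  rw [e]
  refine (frobNorm_sub_le _ _).trans ?_
  rw [frobNorm_smul, frobNorm_smul]
  have k1 := mul_le_mul_of_nonneg_left hAA (abs_nonneg (γ ^ 2 / (η + β)))
  have k2 := mul_le_mul_of_nonneg_left hA (abs_nonneg (η * γ / (η + β)))
  linarith
end

section
/- Let x_t, x_p, x_q, x_p', x_q' ∈ ℝ^d all have Euclidean norm at most R, and let L, L* ∈ ℝ^{r×d} have Frobenius norm at most U. Let α, ξ ∈ [0, 1] and suppose: ⟨L x_t, L x_p⟩ ≥ 0, ⟨L* x_t, L* x_p'⟩ ≤ α‖L* x_t‖₂‖L* x_p'‖₂, ⟨L* x_t, L* x_q'⟩ ≥ −ξ‖L* x_t‖₂‖L* x_q'‖₂, and ⟨L x_t, L x_q⟩ ≤ 0. Then Δ = ‖L x_p‖₂² − ‖L* x_p'‖₂² + ‖L* x_q'‖₂² − ‖L x_q‖₂² − 2⟨L x_t, L x_p⟩ + 2⟨L* x_t, L* x_p'⟩ − 2⟨L* x_t, L* x_q'⟩ + 2⟨L x_t, L x_q⟩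 satisfies Δ ≤ 2(α + ξ + 1)R²U². (Key estimate in the proof of Theorem 3) -/
/-- The Euclidean (ℓ₂) norm of a vector in `ℝ^d`. -/
noncomputable def euclNorm {d : ℕ} (v : Fin d → ℝ) : ℝ := Real.sqrt (∑ i, v i ^ 2)

/-- The Euclidean inner product on `ℝ^r`. -/
def edot {r : ℕ} (v w : Fin r → ℝ) : ℝ := ∑ i, v i * w i

theorem euclNorm_mulVec_le {m n : ℕ} (A : Matrix (Fin m) (Fin n) ℝ) (x : Fin n → ℝ) :
    euclNorm (A.mulVec x) ≤ frobNorm A * euclNorm x := by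
  unfold euclNorm frobNorm
  have h0 : 0 ≤ ∑ i, ∑ j, A i j ^ 2 :=
    Finset.sum_nonneg fun i _ => Finset.sum_nonneg fun j _ => sq_nonneg _
  refine le_of_le_of_eq ?_ (Real.sqrt_mul h0 _)
  apply Real.sqrt_le_sqrt
  rw [Finset.sum_mul]
  apply Finset.sum_le_sum
  intro i _
  exact Finset.sum_mul_sq_le_sq_mul_sq Finset.univ (A i) x

theorem euclNorm_mulVec_le_of {m n : ℕ} {R U : ℝ} (A : Matrix (Fin m) (Fin n) ℝ)
    (x : Fin n → ℝ) (hA : frobNorm A ≤ U) (hx : euclNorm x ≤ R) :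
    euclNorm (A.mulVec x) ≤ U * R :=
  (euclNorm_mulVec_le A x).trans
    (mul_le_mul hA hx (Real.sqrt_nonneg _) ((Real.sqrt_nonneg _).trans hA))

/-- Key estimate in the proof of Theorem 3 of the OPML paper. Under the stated norm,
Frobenius-norm and angle (cosine) conditions, the quantity
`Δ = ‖L x_p‖² - ‖L* x_p'‖² + ‖L* x_q'‖² - ‖L x_q‖² - 2⟨L x_t, L x_p⟩ + 2⟨L* x_t, L* x_p'⟩
     - 2⟨L* x_t, L* x_q'⟩ + 2⟨L x_t, L x_q⟩`
satisfies `Δ ≤ 2(α + ξ + 1) R² U²`. -/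
theorem stmt_12 {d r : ℕ} (R U α ξ : ℝ)
    (xt xp xq xp' xq' : Fin d → ℝ)
    (hxt : euclNorm xt ≤ R) (hxp : euclNorm xp ≤ R) (hxq : euclNorm xq ≤ R)
    (hxp' : euclNorm xp' ≤ R) (hxq' : euclNorm xq' ≤ R)
    (L Lstar : Matrix (Fin r) (Fin d) ℝ)
    (hL : frobNorm L ≤ U) (hLstar : frobNorm Lstar ≤ U)
    (hα0 : 0 ≤ α) (hα1 : α ≤ 1) (hξ0 : 0 ≤ ξ) (hξ1 : ξ ≤ 1)
    (h1 : 0 ≤ edot (L.mulVec xt) (L.mulVec xp))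
    (h2 : edot (Lstar.mulVec xt) (Lstar.mulVec xp') ≤
      α * euclNorm (Lstar.mulVec xt) * euclNorm (Lstar.mulVec xp'))
    (h3 : -(ξ * euclNorm (Lstar.mulVec xt) * euclNorm (Lstar.mulVec xq')) ≤
      edot (Lstar.mulVec xt) (Lstar.mulVec xq'))
    (h4 : edot (L.mulVec xt) (L.mulVec xq) ≤ 0) :
    euclNorm (L.mulVec xp) ^ 2 - euclNorm (Lstar.mulVec xp') ^ 2 +
        euclNorm (Lstar.mulVec xq') ^ 2 - euclNorm (L.mulVec xq) ^ 2 -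
        2 * edot (L.mulVec xt) (L.mulVec xp) +
        2 * edot (Lstar.mulVec xt) (Lstar.mulVec xp') -
        2 * edot (Lstar.mulVec xt) (Lstar.mulVec xq') +
        2 * edot (L.mulVec xt) (L.mulVec xq) ≤
      2 * (α + ξ + 1) * R ^ 2 * U ^ 2 := by
  have nn : ∀ v : Fin r → ℝ, 0 ≤ euclNorm v := fun v => Real.sqrt_nonneg _
  have a := euclNorm_mulVec_le_of L xp hL hxp
  have b := euclNorm_mulVec_le_of Lstar xq' hLstar hxq'
  have c := euclNorm_mulVec_le_of Lstar xt hLstar hxt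
  have e := euclNorm_mulVec_le_of Lstar xp' hLstar hxp'
  have hM : 0 ≤ U * R := (nn _).trans a
  have a2 := pow_le_pow_left₀ (nn _) a 2
  have b2 := pow_le_pow_left₀ (nn _) b 2
  have ce := mul_le_mul_of_nonneg_left (mul_le_mul c e (nn _) hM) hα0
  have cb := mul_le_mul_of_nonneg_left (mul_le_mul c b (nn _) hM) hξ0
  have f := sq_nonneg (euclNorm (Lstar.mulVec xp'))
  have g := sq_nonneg (euclNorm (L.mulVec xq))
  linarith
end

section
/- Let x_t, x_p, x_q ∈ ℝ^d and, for i = 1, …, C, x_{p_i}, x_{q_i} ∈ ℝ^d all have Euclidean norm at most R; let L, L* ∈ ℝ^{r×d} have Frobenius norm at most U. Let α, ξ ∈ [0, 1] and suppose: ⟨L x_t, L x_p⟩ ≥ 0 and ⟨L x_t, L x_q⟩ ≤ 0, and for every i, ⟨L* x_t, L* x_{p_i}⟩ ≤ α‖L* x_t‖₂‖L* x_{p_i}‖₂ and ⟨L* x_t, L* x_{q_i}⟩ ≥ −ξ‖L* x_t‖₂‖L* x_{q_i}‖₂. Define Ψ1 = 1 + ‖L(x_t − x_p)‖₂² − ‖L(x_t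 − x_q)‖₂², assumed nonnegative, and Ψ2 = (1/C)·Σ_{i=1}^{C} max(0, 1 + ‖L*(x_t − x_{p_i})‖₂² − ‖L*(x_t − x_{q_i})‖₂²). Then Ψ1 − Ψ2 ≤ 2(α + ξ + 1)R²U². (Theorem 3, average loss bound between the one-pass and batch triplet construction strategies) -/
theorem aux_nonneg {d : ℕ} (v : Fin d → ℝ) : 0 ≤ euclNorm v := Real.sqrt_nonneg _

theorem aux_sq {d : ℕ} (v : Fin d → ℝ) : euclNorm v ^ 2 = ∑ i, v i ^ 2 :=
  Real.sq_sqrt (Finset.sum_nonneg fun i _ => sq_nonneg (v i))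

theorem aux_sub {r d : ℕ} (L : Matrix (Fin r) (Fin d) ℝ) (x y : Fin d → ℝ) :
    euclNorm (L.mulVec (x - y)) ^ 2 = euclNorm (L.mulVec x) ^ 2
      - 2 * edot (L.mulVec x) (L.mulVec y) + euclNorm (L.mulVec y) ^ 2 := by
  rw [Matrix.mulVec_sub, aux_sq, aux_sq, aux_sq, edot, Finset.mul_sum,
    ← Finset.sum_sub_distrib, ← Finset.sum_add_distrib]
  refine Finset.sum_congr rfl fun i _ => ?_
  simp only [Pi.sub_apply]
  ring

theorem aux_mul {r d : ℕ} (L : Matrix (Fin r) (Fin d) ℝ) (x : Fin d → ℝ) :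
    euclNorm (L.mulVec x) ≤ frobNorm L * euclNorm x := by
  rw [euclNorm, frobNorm, euclNorm, ← Real.sqrt_mul (by positivity), Finset.sum_mul]
  refine Real.sqrt_le_sqrt (Finset.sum_le_sum fun i _ => ?_)
  exact Finset.sum_mul_sq_le_sq_mul_sq Finset.univ (fun j => L i j) x

theorem aux_bd {r d : ℕ} {L : Matrix (Fin r) (Fin d) ℝ} {x : Fin d → ℝ} {U R : ℝ}
    (hL : frobNorm L ≤ U) (hx : euclNorm x ≤ R) : euclNorm (L.mulVec x) ≤ U * R :=
  (aux_mul L x).trans (mul_le_mul hL hx (aux_nonneg x) ((Real.sqrt_nonneg _).trans hL))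

/-- **Theorem 3** (OPML paper, average loss bound between the one-pass and batch triplet
construction strategies). With `Ψ1 = 1 + ‖L(x_t - x_p)‖² - ‖L(x_t - x_q)‖²` (assumed
nonnegative) and `Ψ2 = (1/C) Σᵢ max(0, 1 + ‖L*(x_t - x_{pᵢ})‖² - ‖L*(x_t - x_{qᵢ})‖²)`,
under the stated norm and angle conditions, `Ψ1 - Ψ2 ≤ 2(α + ξ + 1) R² U²`. -/
theorem stmt_13 {d r C : ℕ} (hC : 0 < C) (R U α ξ : ℝ)
    (xt xp xq : Fin d → ℝ) (xP xQ : Fin C → Fin d → ℝ)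
    (hxt : euclNorm xt ≤ R) (hxp : euclNorm xp ≤ R) (hxq : euclNorm xq ≤ R)
    (hxP : ∀ i, euclNorm (xP i) ≤ R) (hxQ : ∀ i, euclNorm (xQ i) ≤ R)
    (L Lstar : Matrix (Fin r) (Fin d) ℝ)
    (hL : frobNorm L ≤ U) (hLstar : frobNorm Lstar ≤ U)
    (hα0 : 0 ≤ α) (hα1 : α ≤ 1) (hξ0 : 0 ≤ ξ) (hξ1 : ξ ≤ 1)
    (h1 : 0 ≤ edot (L.mulVec xt) (L.mulVec xp))
    (h4 : edot (L.mulVec xt) (L.mulVec xq) ≤ 0)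
    (h2 : ∀ i, edot (Lstar.mulVec xt) (Lstar.mulVec (xP i)) ≤
      α * euclNorm (Lstar.mulVec xt) * euclNorm (Lstar.mulVec (xP i)))
    (h3 : ∀ i, -(ξ * euclNorm (Lstar.mulVec xt) * euclNorm (Lstar.mulVec (xQ i))) ≤
      edot (Lstar.mulVec xt) (Lstar.mulVec (xQ i)))
    (hΨ1 : 0 ≤ 1 + euclNorm (L.mulVec (xt - xp)) ^ 2 - euclNorm (L.mulVec (xt - xq)) ^ 2) :
    (1 + euclNorm (L.mulVec (xt - xp)) ^ 2 - euclNorm (L.mulVec (xt - xq)) ^ 2) -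
        (1 / (C : ℝ)) * ∑ i, max 0
          (1 + euclNorm (Lstar.mulVec (xt - xP i)) ^ 2 -
            euclNorm (Lstar.mulVec (xt - xQ i)) ^ 2) ≤
      2 * (α + ξ + 1) * R ^ 2 * U ^ 2 := by
  have key : ∀ i, 1 - (1 + 2 * α + 2 * ξ) * (U * R) ^ 2 ≤ max 0
          (1 + euclNorm (Lstar.mulVec (xt - xP i)) ^ 2 -
            euclNorm (Lstar.mulVec (xt - xQ i)) ^ 2) := by
    intro i
    refine le_trans ?_ (le_max_right _ _)
    rw [aux_sub, aux_sub]
    have ht := aux_bd hLstar hxt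
    have hp := aux_bd hLstar (hxP i)
    have hq := aux_bd hLstar (hxQ i)
    have e2 := h2 i
    have e3 := h3 i
    have t0 := aux_nonneg (Lstar.mulVec xt)
    have p0 := aux_nonneg (Lstar.mulVec (xP i))
    have q0 := aux_nonneg (Lstar.mulVec (xQ i))
    have a1 := mul_le_mul_of_nonneg_left (mul_le_mul ht hp p0 (t0.trans ht)) hα0
    have a2 := mul_le_mul_of_nonneg_left (mul_le_mul ht hq q0 (t0.trans ht)) hξ0
    have a3 := pow_le_pow_left₀ q0 hq 2
    have a4 := sq_nonneg (euclNorm (Lstar.mulVec (xP i)))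
    linarith
  have hsum := Finset.card_nsmul_le_sum Finset.univ _ _ (fun i _ => key i)
  rw [Finset.card_univ, Fintype.card_fin, nsmul_eq_mul] at hsum
  have hC' : (0 : ℝ) < C := by exact_mod_cast hC
  have hb := mul_le_mul_of_nonneg_left hsum (one_div_pos.mpr hC').le
  rw [← mul_assoc, one_div_mul_cancel hC'.ne', one_mul] at hb
  have hp := pow_le_pow_left₀ (aux_nonneg _) (aux_bd hL hxp) 2
  have hq := sq_nonneg (euclNorm (L.mulVec xq))
  have e1 := aux_sub L xt xp
  have e2 := aux_sub L xt xq
  linarith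
end

section
/- Let x_t, x_p, x_q ∈ ℝ^d satisfy ‖x_t‖₂ ≤ 1, ‖x_p‖₂ ≤ 1, ‖x_q‖₂ ≤ 1, set a = x_t − x_p, b = x_t − x_q and A_t = a aᵀ − b bᵀ, let 0 < γ < 1/4, and fix L₀ ∈ ℝ^{r×d}. Then the function Γ(L) = ½‖L − L₀‖_F² + (γ/2)(1 + ‖L a‖₂² − ‖L b‖₂²) on ℝ^{r×d} attains its unique global minimum at L = L₀ (I + γ A_t)⁻¹; that is, Γ(L) ≥ Γ(L₀(I + γ A_t)⁻¹) for all L, with equality only for L = L₀(I + γ A_t)⁻¹. (Optimality of the OPML closed-form update in the active case) -/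
lemma euclNorm_sq_aux {d : ℕ} (v : Fin d → ℝ) : euclNorm v ^ 2 = v ⬝ᵥ v := by
  unfold euclNorm
  rw [Real.sq_sqrt (Finset.sum_nonneg fun i _ => sq_nonneg _)]
  simp [dotProduct, sq]

lemma frobNorm_sq_aux {m n : ℕ} (X : Matrix (Fin m) (Fin n) ℝ) :
    frobNorm X ^ 2 = ∑ i, X i ⬝ᵥ X i := by
  unfold frobNorm
  have h : 0 ≤ ∑ i, ∑ j, X i j ^ 2 :=
    Finset.sum_nonneg fun i _ => Finset.sum_nonneg fun j _ => sq_nonneg _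
  refine (Real.sq_sqrt h).trans ?_
  simp [dotProduct, sq]

lemma dot_self_nonneg_aux {d : ℕ} (v : Fin d → ℝ) : 0 ≤ v ⬝ᵥ v :=
  Finset.sum_nonneg fun i _ => mul_self_nonneg _

lemma dot_cs_aux {d : ℕ} (v w : Fin d → ℝ) : (v ⬝ᵥ w) ^ 2 ≤ (v ⬝ᵥ v) * (w ⬝ᵥ w) := by
  have := Finset.sum_mul_sq_le_sq_mul_sq Finset.univ v w
  simpa [dotProduct, sq] using this

lemma dot_b_le_aux {d : ℕ} (x y : Fin d → ℝ) (hx : euclNorm x ≤ 1) (hy : euclNorm y ≤ 1) :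
    (x - y) ⬝ᵥ (x - y) ≤ 4 := by
  have hx2 : x ⬝ᵥ x ≤ 1 := by
    rw [← euclNorm_sq_aux]
    exact pow_le_one₀ (Real.sqrt_nonneg _) hx
  have hy2 : y ⬝ᵥ y ≤ 1 := by
    rw [← euclNorm_sq_aux]
    exact pow_le_one₀ (Real.sqrt_nonneg _) hy
  have h := dot_self_nonneg_aux (x + y)
  simp only [add_dotProduct, dotProduct_add] at h
  simp only [sub_dotProduct, dotProduct_sub]
  linarith

lemma quad_aux {d : ℕ} (a b v : Fin d → ℝ) (hb : b ⬝ᵥ b ≤ 4) (γ : ℝ) (hγ0 : 0 < γ) :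
    (1 - 4 * γ) * (v ⬝ᵥ v) ≤ v ⬝ᵥ v + γ * ((v ⬝ᵥ a) ^ 2 - (v ⬝ᵥ b) ^ 2) := by
  have h1 := dot_cs_aux v b
  have h2 : (v ⬝ᵥ v) * (b ⬝ᵥ b) ≤ (v ⬝ᵥ v) * 4 :=
    mul_le_mul_of_nonneg_left hb (dot_self_nonneg_aux v)
  have h3 : γ * (v ⬝ᵥ b) ^ 2 ≤ γ * ((v ⬝ᵥ v) * 4) :=
    mul_le_mul_of_nonneg_left (h1.trans h2) hγ0.le
  have h4 : 0 ≤ γ * (v ⬝ᵥ a) ^ 2 := by positivity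
  linarith

lemma vecMul_aux {d : ℕ} (a b u : Fin d → ℝ) (γ : ℝ) :
    Matrix.vecMul u ((1 : Matrix (Fin d) (Fin d) ℝ) +
      γ • (Matrix.vecMulVec a a - Matrix.vecMulVec b b))
      = u + γ • ((u ⬝ᵥ a) • a - (u ⬝ᵥ b) • b) := by
  rw [Matrix.vecMul_add, Matrix.vecMul_one, Matrix.vecMul_smul, Matrix.vecMul_sub,
    Matrix.vecMul_vecMulVec, Matrix.vecMul_vecMulVec]

lemma row_aux {d : ℕ} (a b u l l0 : Fin d → ℝ) (γ : ℝ)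
    (h : l0 = u + γ • ((u ⬝ᵥ a) • a - (u ⬝ᵥ b) • b)) :
    (1 / 2) * ((l - l0) ⬝ᵥ (l - l0)) + (γ / 2) * ((l ⬝ᵥ a) ^ 2 - (l ⬝ᵥ b) ^ 2)
    = (1 / 2) * ((u - l0) ⬝ᵥ (u - l0)) + (γ / 2) * ((u ⬝ᵥ a) ^ 2 - (u ⬝ᵥ b) ^ 2)
      + (1 / 2) * ((l - u) ⬝ᵥ (l - u) +
        γ * (((l - u) ⬝ᵥ a) ^ 2 - ((l - u) ⬝ᵥ b) ^ 2)) := by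
  have e1 : ∀ w : Fin d → ℝ, w ⬝ᵥ l0 = w ⬝ᵥ u + γ * ((u ⬝ᵥ a) * (w ⬝ᵥ a) - (u ⬝ᵥ b) * (w ⬝ᵥ b)) := by
    intro w
    rw [h]
    simp [dotProduct_add, dotProduct_sub, dotProduct_smul]
  simp only [sub_dotProduct, dotProduct_sub, dotProduct_comm l0 l, dotProduct_comm l0 u,
    dotProduct_comm u l, e1 l, e1 u]
  ring

/-- Optimality of the OPML closed-form update in the active case. For normalized samples,
`a = x_t - x_p`, `b = x_t - x_q`, `A_t = a aᵀ - b bᵀ` and `0 < γ < 1/4`, the function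
`Γ(L) = ½‖L - L₀‖_F² + (γ/2)(1 + ‖L a‖₂² - ‖L b‖₂²)` attains its unique global minimum at
`L = L₀ (I + γ A_t)⁻¹`. -/
theorem stmt_16 {d r : ℕ} (xt xp xq : Fin d → ℝ)
    (ht : euclNorm xt ≤ 1) (hp : euclNorm xp ≤ 1) (hq : euclNorm xq ≤ 1)
    (γ : ℝ) (hγ0 : 0 < γ) (hγ1 : γ < 1 / 4)
    (L0 : Matrix (Fin r) (Fin d) ℝ) :
    let A : Matrix (Fin d) (Fin d) ℝ :=
      Matrix.vecMulVec (xt - xp) (xt - xp) - Matrix.vecMulVec (xt - xq) (xt - xq)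
    let Gam : Matrix (Fin r) (Fin d) ℝ → ℝ := fun L =>
      (1 / 2) * frobNorm (L - L0) ^ 2 +
        (γ / 2) * (1 + euclNorm (L.mulVec (xt - xp)) ^ 2 - euclNorm (L.mulVec (xt - xq)) ^ 2)
    let Lmin : Matrix (Fin r) (Fin d) ℝ :=
      L0 * ((1 : Matrix (Fin d) (Fin d) ℝ) + γ • A)⁻¹
    (∀ L, Gam Lmin ≤ Gam L) ∧ ∀ L, Gam L = Gam Lmin → L = Lmin := by
  intro A Gam Lmin
  have hb := dot_b_le_aux xt xq ht hq
  set a := xt - xp with ha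
  set b := xt - xq with hbdef
  have hpos : 0 < 1 - 4 * γ := by linarith
  have hunit : IsUnit ((1 : Matrix (Fin d) (Fin d) ℝ) + γ • A) := by
    rw [← Matrix.vecMul_injective_iff_isUnit]
    intro u w huw
    have h0 : Matrix.vecMul (u - w) ((1 : Matrix (Fin d) (Fin d) ℝ) + γ • A) = 0 := by
      rw [Matrix.sub_vecMul]
      exact sub_eq_zero.mpr huw
    have h1 := vecMul_aux a b (u - w) γ
    rw [show Matrix.vecMul (u - w) _ = 0 from h0] at h1
    have h2 := congrArg (fun z => (u - w) ⬝ᵥ z) h1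
    simp only [dotProduct_zero, dotProduct_add, dotProduct_sub, dotProduct_smul,
      smul_eq_mul] at h2
    simp only [← dotProduct_sub] at h2
    have h3 := quad_aux a b (u - w) hb γ hγ0
    have h4 : (u - w) ⬝ᵥ (u - w) = 0 := by
      have := dot_self_nonneg_aux (u - w)
      nlinarith
    exact sub_eq_zero.mp (dotProduct_self_eq_zero.mp h4)
  have hL : Lmin * ((1 : Matrix (Fin d) (Fin d) ℝ) + γ • A) = L0 := by
    have hdet := (Matrix.isUnit_iff_isUnit_det _).mp hunit
    exact Matrix.nonsing_inv_mul_cancel_right _ _ hdet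
  have hrow : ∀ i, L0 i = Lmin i + γ • ((Lmin i ⬝ᵥ a) • a - (Lmin i ⬝ᵥ b) • b) := by
    intro i
    rw [← vecMul_aux a b (Lmin i) γ]
    conv_lhs => rw [← hL]
    rfl
  have hGam : ∀ L, Gam L = γ / 2 + ∑ i, ((1 / 2) * ((L i - L0 i) ⬝ᵥ (L i - L0 i)) +
      (γ / 2) * ((L i ⬝ᵥ a) ^ 2 - (L i ⬝ᵥ b) ^ 2)) := by
    intro L
    simp only [Gam]
    rw [frobNorm_sq_aux, euclNorm_sq_aux, euclNorm_sq_aux, Finset.sum_add_distrib,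
      ← Finset.mul_sum, ← Finset.mul_sum, Finset.sum_sub_distrib]
    have e : ∀ c : Fin d → ℝ, L.mulVec c ⬝ᵥ L.mulVec c = ∑ i, (L i ⬝ᵥ c) ^ 2 := by
      intro c
      simp only [sq]
      rfl
    rw [e, e]
    have e2 : ∑ i, (L - L0) i ⬝ᵥ (L - L0) i = ∑ i, (L i - L0 i) ⬝ᵥ (L i - L0 i) := rfl
    rw [e2]
    ring
  have key : ∀ L, Gam L = Gam Lmin + ∑ i, (1 / 2) * ((L i - Lmin i) ⬝ᵥ (L i - Lmin i) +
        γ * (((L i - Lmin i) ⬝ᵥ a) ^ 2 - ((L i - Lmin i) ⬝ᵥ b) ^ 2)) := by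
    intro L
    rw [hGam L, hGam Lmin, add_assoc, ← Finset.sum_add_distrib]
    congr 1
    exact Finset.sum_congr rfl fun i _ => row_aux a b (Lmin i) (L i) (L0 i) γ (hrow i)
  have hnn : ∀ L : Matrix (Fin r) (Fin d) ℝ, ∀ i ∈ Finset.univ,
      0 ≤ (1 / 2) * ((L i - Lmin i) ⬝ᵥ (L i - Lmin i) +
        γ * (((L i - Lmin i) ⬝ᵥ a) ^ 2 - ((L i - Lmin i) ⬝ᵥ b) ^ 2)) := by
    intro L i _
    have h1 := quad_aux a b (L i - Lmin i) hb γ hγ0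
    have h2 := mul_nonneg hpos.le (dot_self_nonneg_aux (L i - Lmin i))
    linarith
  refine ⟨fun L => ?_, fun L hE => ?_⟩
  · rw [key L]
    linarith [Finset.sum_nonneg (hnn L)]
  · rw [key L] at hE
    have hs := (Finset.sum_eq_zero_iff_of_nonneg (hnn L)).mp (by linarith)
    funext i
    have h0 := hs i (Finset.mem_univ i)
    have h1 := quad_aux a b (L i - Lmin i) hb γ hγ0
    have h2 := dot_self_nonneg_aux (L i - Lmin i)
    have h4 : (L i - Lmin i) ⬝ᵥ (L i - Lmin i) = 0 := by nlinarith
    exact sub_eq_zero.mp (dotProduct_self_eq_zero.mp h4)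
end
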